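/- Let n ≥ 1 be an integer and suppose < is a left-invariant linear order on G_n with 1 < b⁻¹·a. Then 1 < d⁻¹·a². -/

import Mathlib

/-- The four generators of the Kanenobu group `G n`. -/
inductive Gen : Type
  | a | b | c | d
  deriving DecidableEq

open FreeGroup in
/-- The four relators of the presentation of `G n`. -/
def kanenobuRels (n : ℕ) : Set (FreeGroup Gen) :=
  { ((of Gen.a)⁻¹ * of Gen.b) ^ (10 * n) * (of Gen.d)⁻¹ * (of Gen.a) ^ 2,
    ((of Gen.b)⁻¹) ^ 2 * of Gen.c * ((of Gen.b)⁻¹ * of Gen.a) ^ (10 * n),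
    ((of Gen.d)⁻¹ * of Gen.c) ^ (10 * n + 3) * (of Gen.c)⁻¹ * of Gen.b * ((of Gen.c)⁻¹) ^ 2,
    (of Gen.d) ^ 2 * (of Gen.a)⁻¹ * of Gen.d * ((of Gen.c)⁻¹ * of Gen.d) ^ (10 * n + 3) }

/-- The group `G n`, fundamental group of the double branched cover of `K_{-10n,10n+3}`. -/
abbrev G (n : ℕ) : Type := PresentedGroup (kanenobuRels n)

/-- The image of the generator `a` in `G n`. -/
def ga (n : ℕ) : G n := PresentedGroup.of Gen.a
/-- The image of the generator `b` in `G n`. -/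
def gb (n : ℕ) : G n := PresentedGroup.of Gen.b
/-- The image of the generator `c` in `G n`. -/
def gc (n : ℕ) : G n := PresentedGroup.of Gen.c
/-- The image of the generator `d` in `G n`. -/
def gd (n : ℕ) : G n := PresentedGroup.of Gen.d

/-- `lt` is a left-invariant linear (strict total) order on the group `G`. -/
def IsLeftInvariantLinearOrder (G : Type*) [Group G] (lt : G → G → Prop) : Prop :=
  IsStrictTotalOrder G lt ∧ ∀ f g h : G, lt g h → lt (f * g) (f * h)

theorem pos_pow_aux {H : Type*} [Group H] (lt : H → H → Prop)
    (hlt : IsLeftInvariantLinearOrder H lt) (x : H) (hx : lt 1 x) (k : ℕ) :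
    lt 1 (x ^ (k + 1)) := by
  obtain ⟨ho, hl⟩ := hlt
  induction k with
  | zero => simpa using hx
  | succ k ih =>
    have h := hl (x ^ (k + 1)) 1 x hx
    rw [mul_one, ← pow_succ] at h
    exact ho.toIsStrictOrder.toIsTrans.trans _ _ _ ih h

theorem rel_aux (n : ℕ) :
    ((ga n)⁻¹ * gb n) ^ (10 * n) * (gd n)⁻¹ * (ga n) ^ 2 = 1 :=
  PresentedGroup.one_of_mem (rels := kanenobuRels n) (Or.inl rfl)

/-- then `1 < d⁻¹·a²`. -/
theorem pos_dinv_a_sq (n : ℕ) (hn : 1 ≤ n) (lt : G n → G n → Prop)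
    (hlt : IsLeftInvariantLinearOrder (G n) lt) (hba : lt 1 ((gb n)⁻¹ * ga n)) :
    lt 1 ((gd n)⁻¹ * (ga n) ^ 2) := by
  have h : (gd n)⁻¹ * (ga n) ^ 2 = ((gb n)⁻¹ * ga n) ^ (10 * n) := by
    have h1 := rel_aux n
    rw [mul_assoc] at h1
    rw [eq_inv_of_mul_eq_one_right h1, ← inv_pow, mul_inv_rev, inv_inv]
  rw [h]
  obtain ⟨k, hk⟩ : ∃ k, 10 * n = k + 1 := ⟨10 * n - 1, by omega⟩
  rw [hk]
  exact pos_pow_aux lt hlt _ hba k
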